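/- Let 𝕋 be a pretheory. Every derivable standard judgment of 𝕋 has the substitution property: if X ⊢ U sort (respectively X ⊢ u : U, X ⊢ U ≡ U' sort, X ⊢ u ≡ u' : U) is derivable and f : Y → X is a context morphism, then Y ⊢ U[f] sort (respectively Y ⊢ u[f] : U[f], Y ⊢ U[f] ≡ U'[f] sort, Y ⊢ u[f] ≡ u'[f] : U[f]) is derivable. -/

import Mathlib

set_option linter.unusedVariables false

/-! # Syntax of generalized algebraic theories (following Cartmell / the paper's appendix) -/

namespace GATPaper

/-- A sort-and-term alphabet: a countably infinite set of variables, a set of sort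
symbols and a set of term symbols. -/
structure Alphabet : Type 1 where
  Var : Type
  SortSym : Type
  TermSym : Type
  var_infinite : Infinite Var
  var_countable : Countable Var

attribute [instance] Alphabet.var_infinite Alphabet.var_countable

variable {A B : Alphabet}

/-- Term expressions over an alphabet. -/
inductive Expr (A : Alphabet) : Type where
  | var : A.Var → Expr A
  | app : A.TermSym → List (Expr A) → Expr A

/-- Sort expressions: a sort symbol applied to a list of term expressions. -/
structure SortE (A : Alphabet) : Type where
  head : A.SortSym
  args : List (Expr A)

/-- Occurrence of a variable in a term expression. -/
inductive Occurs (x : A.Var) : Expr A → Prop where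
  | var : Occurs x (Expr.var x)
  | app {t : A.TermSym} {es : List (Expr A)} {e : Expr A} :
      e ∈ es → Occurs x e → Occurs x (Expr.app t es)

/-- Occurrence of a variable in a sort expression. -/
def SOccurs (x : A.Var) (U : SortE A) : Prop := ∃ e ∈ U.args, Occurs x e

/-- Simultaneous substitution along a function on variables. -/
def Expr.subst (σ : A.Var → Expr A) : Expr A → Expr A
  | .var x => σ x
  | .app t es => .app t (es.attach.map fun e => Expr.subst σ e.1)
termination_by e => sizeOf e
decreasing_by
  have := List.sizeOf_lt_of_mem e.2
  simp only [Expr.app.sizeOf_spec]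
  omega

def SortE.subst (σ : A.Var → Expr A) (U : SortE A) : SortE A :=
  ⟨U.head, U.args.map (Expr.subst σ)⟩

open Classical in
/-- The function on variables determined by a finite list of substitution pairs
`(zᵢ, uᵢ)` (substituting `uᵢ` for `zᵢ`, first matching pair winning, all other
variables unchanged). -/
noncomputable def lookupV : List (A.Var × Expr A) → A.Var → Expr A
  | [], x => .var x
  | p :: ps, x => if p.1 = x then p.2 else lookupV ps x

/-- The simultaneous substitution `e[u₁ | z₁, …, u_k | z_k]` where
`ps = [(z₁,u₁),…,(z_k,u_k)]`. -/
noncomputable def Expr.substL (e : Expr A) (ps : List (A.Var × Expr A)) : Expr A :=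
  e.subst (lookupV ps)

noncomputable def SortE.substL (U : SortE A) (ps : List (A.Var × Expr A)) : SortE A :=
  U.subst (lookupV ps)

/-- A (pre)context is a finite list of (variable, sort expression) pairs. -/
abbrev PreCtx (A : Alphabet) := List (A.Var × SortE A)

/-- The list of variables of a precontext, as term expressions. -/
def ctxVars (X : PreCtx A) : List (Expr A) := X.map fun p => Expr.var p.1

/-- The scoping condition of a precontext: the `i`-th sort expression only contains
variables among the first `i` variables. -/
def IsPreCtx (X : PreCtx A) : Prop :=
  ∀ i (hi : i < X.length) (v : A.Var),
    SOccurs v (X[i]'hi).2 → v ∈ (X.take i).map Prod.fst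

/-- Substitution pairs sending the variables of `X` to the entries of `f`. -/
def mkSub (X : PreCtx A) (f : List (Expr A)) : List (A.Var × Expr A) :=
  (X.map Prod.fst).zip f

/-- `Xᵢ[f₁ | x₁, …, f_{i-1} | x_{i-1}]` (0-based: the `i`-th sort of `X`
substituted along the first `i` entries of `f`). -/
noncomputable def subPre (X : PreCtx A) (f : List (Expr A)) (i : ℕ) (hi : i < X.length) :
    SortE A :=
  ((X[i]'hi).2).substL (mkSub (X.take i) (f.take i))

/-- Judgments: context judgments and the four kinds of standard judgments. -/
inductive Judg (A : Alphabet) : Type where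
  | ctx (X : PreCtx A)
  | sort (X : PreCtx A) (U : SortE A)
  | term (X : PreCtx A) (u : Expr A) (U : SortE A)
  | sortEq (X : PreCtx A) (U V : SortE A)
  | termEq (X : PreCtx A) (u v : Expr A) (U : SortE A)

/-- The context of a judgment. -/
def Judg.ctxOf : Judg A → PreCtx A
  | .ctx X => X
  | .sort X _ => X
  | .term X _ _ => X
  | .sortEq X _ _ => X
  | .termEq X _ _ _ => X

/-- The judgment introducing a sort symbol over the context `X`. -/
def introSort (X : PreCtx A) (S : A.SortSym) : Judg A := .sort X ⟨S, ctxVars X⟩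

/-- The judgment introducing a term symbol over the context `X`, with sort `U`. -/
def introTerm (X : PreCtx A) (t : A.TermSym) (U : SortE A) : Judg A :=
  .term X (.app t (ctxVars X)) U

/-- A set of axioms is a pretheory if: no axiom is a context judgment, every
axiom's context is a precontext, every sort symbol has a unique introducing sort
axiom and there are no other sort axioms, and likewise for term symbols. -/
structure IsPretheory (Ax : Set (Judg A)) : Prop where
  no_ctx : ∀ X : PreCtx A, Judg.ctx X ∉ Ax
  wf_ctx : ∀ J ∈ Ax, IsPreCtx J.ctxOf
  sort_intro : ∀ S : A.SortSym, ∃! X : PreCtx A, introSort X S ∈ Ax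
  sort_shape : ∀ (X : PreCtx A) (U : SortE A), Judg.sort X U ∈ Ax → U.args = ctxVars X
  term_intro : ∀ t : A.TermSym, ∃! p : PreCtx A × SortE A, introTerm p.1 t p.2 ∈ Ax
  term_shape : ∀ (X : PreCtx A) (u : Expr A) (U : SortE A), Judg.term X u U ∈ Ax →
      ∃ t : A.TermSym, u = Expr.app t (ctxVars X)

/-- One inference step of the paper's system: `Step Ax D J` holds when `J` is the
conclusion of an instance of one of the sixteen rules all of whose premises
satisfy `D`. -/
inductive Step (Ax : Set (Judg A)) (D : Judg A → Prop) : Judg A → Prop where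
  | ctx_nil : Step Ax D (.ctx [])
  | ctx_cons {X : PreCtx A} {U : SortE A} {x : A.Var}
      (hs : D (.sort X U)) (hfresh : ∀ p ∈ X, p.1 ≠ x)
      (hpre : IsPreCtx (X ++ [(x, U)])) :
      Step Ax D (.ctx (X ++ [(x, U)]))
  | s1 {X : PreCtx A} {U : SortE A} (h : D (.sort X U)) : Step Ax D (.sortEq X U U)
  | s2 {X : PreCtx A} {U V : SortE A} (h : D (.sortEq X U V)) : Step Ax D (.sortEq X V U)
  | s3 {X : PreCtx A} {U V W : SortE A}
      (h1 : D (.sortEq X U V)) (h2 : D (.sortEq X V W)) : Step Ax D (.sortEq X U W)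
  | t1 {X : PreCtx A} {u : Expr A} {U : SortE A}
      (h : D (.term X u U)) : Step Ax D (.termEq X u u U)
  | t2 {X : PreCtx A} {u v : Expr A} {U : SortE A}
      (h : D (.termEq X u v U)) : Step Ax D (.termEq X v u U)
  | t3 {X : PreCtx A} {u v w : Expr A} {U : SortE A}
      (h1 : D (.termEq X u v U)) (h2 : D (.termEq X v w U)) : Step Ax D (.termEq X u w U)
  | seqt {X : PreCtx A} {U U' : SortE A} {u : Expr A}
      (h1 : D (.sortEq X U U')) (h2 : D (.term X u U)) : Step Ax D (.term X u U')
  | seqteq {X : PreCtx A} {U U' : SortE A} {u u' : Expr A}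
      (h1 : D (.sortEq X U U')) (h2 : D (.termEq X u u' U))
      (h3 : D (.term X u U')) (h4 : D (.term X u' U')) : Step Ax D (.termEq X u u' U')
  | var {X : PreCtx A} {i : ℕ} (hi : i < X.length)
      (h : D (.sort X (X[i]'hi).2)) :
      Step Ax D (.term X (.var (X[i]'hi).1) (X[i]'hi).2)
  | sA {X : PreCtx A} {U : SortE A} (hax : Judg.sort X U ∈ Ax) (h : D (.ctx X))
      (hv : ∀ i (hi : i < X.length), D (.term X (.var (X[i]'hi).1) (X[i]'hi).2)) :
      Step Ax D (.sort X U)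
  | tA {X : PreCtx A} {u : Expr A} {U : SortE A} (hax : Judg.term X u U ∈ Ax)
      (h : D (.sort X U))
      (hv : ∀ i (hi : i < X.length), D (.term X (.var (X[i]'hi).1) (X[i]'hi).2)) :
      Step Ax D (.term X u U)
  | seqA {X : PreCtx A} {U U' : SortE A} (hax : Judg.sortEq X U U' ∈ Ax)
      (h1 : D (.sort X U)) (h2 : D (.sort X U')) : Step Ax D (.sortEq X U U')
  | teqA {X : PreCtx A} {u u' : Expr A} {U : SortE A} (hax : Judg.termEq X u u' U ∈ Ax)
      (h1 : D (.term X u U)) (h2 : D (.term X u' U)) : Step Ax D (.termEq X u u' U)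
  | sSub {X : PreCtx A} {S : A.SortSym} (hax : introSort X S ∈ Ax)
      {Y : PreCtx A} (hY : IsPreCtx Y) {f : List (Expr A)} (hlen : f.length = X.length)
      (hJ : D (introSort X S)) (hYc : D (.ctx Y))
      (hargs : ∀ i (hi : i < X.length) (hif : i < f.length),
        D (.term Y (f[i]'hif) (subPre X f i hi))) :
      Step Ax D (.sort Y ⟨S, f⟩)
  | tSub {X : PreCtx A} {t : A.TermSym} {U : SortE A} (hax : introTerm X t U ∈ Ax)
      {Y : PreCtx A} (hY : IsPreCtx Y) {f : List (Expr A)} (hlen : f.length = X.length)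
      (hJ : D (introTerm X t U))
      (hU : D (.sort Y (U.substL (mkSub X f))))
      (hargs : ∀ i (hi : i < X.length) (hif : i < f.length),
        D (.term Y (f[i]'hif) (subPre X f i hi))) :
      Step Ax D (.term Y (.app t f) (U.substL (mkSub X f)))
  | seqSub1 {X : PreCtx A} {U U' : SortE A} (hax : Judg.sortEq X U U' ∈ Ax)
      {Y : PreCtx A} (hY : IsPreCtx Y) {f : List (Expr A)} (hlen : f.length = X.length)
      (hJ : D (.sortEq X U U'))
      (h1 : D (.sort Y (U.substL (mkSub X f)))) (h2 : D (.sort Y (U'.substL (mkSub X f))))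
      (hargs : ∀ i (hi : i < X.length) (hif : i < f.length),
        D (.term Y (f[i]'hif) (subPre X f i hi))) :
      Step Ax D (.sortEq Y (U.substL (mkSub X f)) (U'.substL (mkSub X f)))
  | seqSub2 {X : PreCtx A} {S : A.SortSym} (hax : introSort X S ∈ Ax)
      {Y : PreCtx A} (hY : IsPreCtx Y) {f g : List (Expr A)}
      (hlf : f.length = X.length) (hlg : g.length = X.length)
      (hJ : D (introSort X S))
      (h1 : D (.sort Y ⟨S, f⟩)) (h2 : D (.sort Y ⟨S, g⟩))
      (hargs : ∀ i (hi : i < X.length) (hif : i < f.length) (hig : i < g.length),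
        D (.termEq Y (f[i]'hif) (g[i]'hig) (subPre X f i hi))) :
      Step Ax D (.sortEq Y ⟨S, f⟩ ⟨S, g⟩)
  | teqSub1 {X : PreCtx A} {u u' : Expr A} {U : SortE A}
      (hax : Judg.termEq X u u' U ∈ Ax)
      {Y : PreCtx A} (hY : IsPreCtx Y) {f : List (Expr A)} (hlen : f.length = X.length)
      (hJ : D (.termEq X u u' U))
      (h1 : D (.term Y (u.substL (mkSub X f)) (U.substL (mkSub X f))))
      (h2 : D (.term Y (u'.substL (mkSub X f)) (U.substL (mkSub X f))))
      (hargs : ∀ i (hi : i < X.length) (hif : i < f.length),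
        D (.term Y (f[i]'hif) (subPre X f i hi))) :
      Step Ax D (.termEq Y (u.substL (mkSub X f)) (u'.substL (mkSub X f))
        (U.substL (mkSub X f)))
  | teqSub2 {X : PreCtx A} {t : A.TermSym} {U : SortE A} (hax : introTerm X t U ∈ Ax)
      {Y : PreCtx A} (hY : IsPreCtx Y) {f g : List (Expr A)}
      (hlf : f.length = X.length) (hlg : g.length = X.length)
      (hJ : D (introTerm X t U))
      (h1 : D (.term Y (.app t f) (U.substL (mkSub X f))))
      (h2 : D (.term Y (.app t g) (U.substL (mkSub X f))))
      (hargs : ∀ i (hi : i < X.length) (hif : i < f.length) (hig : i < g.length),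
        D (.termEq Y (f[i]'hif) (g[i]'hig) (subPre X f i hi))) :
      Step Ax D (.termEq Y (.app t f) (.app t g) (U.substL (mkSub X f)))

/-- `DerAt Ax n J`: `J` is the conclusion of an inference step in the `n`-th stage
`𝒟ₙ` of the recursive construction of the derivable judgments. -/
def DerAt (Ax : Set (Judg A)) : ℕ → Judg A → Prop
  | 0, _ => False
  | n + 1, J => DerAt Ax n J ∨ Step Ax (DerAt Ax n) J

/-- A judgment is derivable if it is the conclusion of a step of some stage. -/
def Derivable (Ax : Set (Judg A)) (J : Judg A) : Prop := ∃ n, DerAt Ax n J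

/-- The height of a (derivable) judgment: the least stage at which it appears. -/
noncomputable def ht (Ax : Set (Judg A)) (J : Judg A) : ℕ := sInf {n | DerAt Ax n J}

/-- The height of a context: `0` for the empty context, and the height of
`∂X ⊢ Xₙ sort` otherwise. -/
noncomputable def htCtx (Ax : Set (Judg A)) (X : PreCtx A) : ℕ :=
  match X with
  | [] => 0
  | p :: X' =>
      ht Ax (.sort ((p :: X').dropLast) (((p :: X').getLast (List.cons_ne_nil p X')).2))

/-- A generalized algebraic theory: a pretheory all of whose axioms are derivable. -/
def IsGAT (Ax : Set (Judg A)) : Prop := IsPretheory Ax ∧ ∀ J ∈ Ax, Derivable Ax J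

/-- The partial term judgment `X ⊢ u term` is derivable. -/
def DerTerm (Ax : Set (Judg A)) (X : PreCtx A) (u : Expr A) : Prop :=
  ∃ U, Derivable Ax (.term X u U)

/-- The partial term equality judgment `X ⊢ u ≡ v term` is derivable. -/
def DerTermEq (Ax : Set (Judg A)) (X : PreCtx A) (u v : Expr A) : Prop :=
  ∃ U, Derivable Ax (.termEq X u v U)

/-- Height of a derivable partial term judgment: the minimum of the heights of
`X ⊢ u : U` over all `U`. -/
noncomputable def htTerm (Ax : Set (Judg A)) (X : PreCtx A) (u : Expr A) : ℕ :=
  sInf {n | ∃ U, DerAt Ax n (.term X u U)}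

/-- `f` is a context morphism from `X` to `Y`. -/
def IsMor (Ax : Set (Judg A)) (X Y : PreCtx A) (f : List (Expr A)) : Prop :=
  Derivable Ax (.ctx X) ∧ Derivable Ax (.ctx Y) ∧ f.length = Y.length ∧
  ∀ i (hi : i < Y.length) (hif : i < f.length),
    Derivable Ax (.term X (f[i]'hif) (subPre Y f i hi))

/-- The morphism equality `f ≡ g : X → Y` is derivable. -/
def MorEq (Ax : Set (Judg A)) (X Y : PreCtx A) (f g : List (Expr A)) : Prop :=
  IsMor Ax X Y f ∧ IsMor Ax X Y g ∧
  ∀ i (hi : i < Y.length) (hif : i < f.length) (hig : i < g.length),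
    Derivable Ax (.termEq X (f[i]'hif) (g[i]'hig) (subPre Y f i hi))

/-- The context equality `X ≡ Y ctx` is derivable. -/
def CtxEq (Ax : Set (Judg A)) (X Y : PreCtx A) : Prop :=
  X.length = Y.length ∧ Derivable Ax (.ctx X) ∧ Derivable Ax (.ctx Y) ∧
  ∀ i (hX : i < X.length) (hY : i < Y.length),
    Derivable Ax (.sortEq (X.take i) (X[i]'hX).2
      (((Y[i]'hY).2).substL (mkSub (Y.take i) (ctxVars (X.take i)))))

/-- Height of a context morphism. -/
noncomputable def htMor (Ax : Set (Judg A)) (X Y : PreCtx A) (f : List (Expr A)) : ℕ :=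
  max (htCtx Ax X) (max (htCtx Ax Y)
    ((Finset.range Y.length).sup fun i =>
      if h : i < Y.length ∧ i < f.length then
        ht Ax (.term X (f[i]'h.2) (subPre Y f i h.1))
      else 0))

/-- Height of a morphism equality. -/
noncomputable def htMorEq (Ax : Set (Judg A)) (X Y : PreCtx A) (f g : List (Expr A)) : ℕ :=
  max (htMor Ax X Y f) (max (htMor Ax X Y g)
    ((Finset.range Y.length).sup fun i =>
      if h : i < Y.length ∧ i < f.length ∧ i < g.length then
        ht Ax (.termEq X (f[i]'h.2.1) (g[i]'h.2.2) (subPre Y f i h.1))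
      else 0))

/-- The composite `g ∘ f` of tuples of term expressions, where `f : X → Y` and
`g : Y → Z`: the `i`-th entry is `gᵢ[f]`. -/
noncomputable def compMor (Y : PreCtx A) (f g : List (Expr A)) : List (Expr A) :=
  g.map fun e => e.substL (mkSub Y f)

/-- The canonical sort `𝒮(u)` of a term in a context (as a relation). -/
inductive CanonSort (Ax : Set (Judg A)) (X : PreCtx A) : Expr A → SortE A → Prop where
  | var {i : ℕ} (hi : i < X.length) : CanonSort Ax X (.var (X[i]'hi).1) (X[i]'hi).2
  | app {t : A.TermSym} {f : List (Expr A)} {Xa : PreCtx A} {V : SortE A}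
      (hax : introTerm Xa t V ∈ Ax) :
      CanonSort Ax X (.app t f) (V.substL (mkSub Xa f))

theorem Expr.subst_app (σ : A.Var → Expr A) (t : A.TermSym) (es : List (Expr A)) :
    (Expr.app t es).subst σ = .app t (es.map (Expr.subst σ)) := by
  rw [Expr.subst]
  simp

theorem Expr.rec_mem {P : Expr A → Prop} (hvar : ∀ x, P (.var x))
    (happ : ∀ t es, (∀ e ∈ es, P e) → P (.app t es)) : ∀ e, P e
  | .var x => hvar x
  | .app t es => happ t es fun e he => Expr.rec_mem hvar happ e
termination_by e => sizeOf e
decreasing_by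
  have := List.sizeOf_lt_of_mem he
  simp only [Expr.app.sizeOf_spec]
  omega

theorem Expr.subst_congr {σ τ : A.Var → Expr A} (e : Expr A)
    (h : ∀ v, Occurs v e → σ v = τ v) : e.subst σ = e.subst τ := by
  induction e using Expr.rec_mem with
  | hvar x => simpa [Expr.subst] using h x .var
  | happ t es ih =>
    simp only [Expr.subst_app, Expr.app.injEq, true_and]
    exact List.map_congr_left fun e he => ih e he fun v hv => h v (.app he hv)

theorem Expr.subst_subst (σ τ : A.Var → Expr A) (e : Expr A) :
    (e.subst σ).subst τ = e.subst fun v => (σ v).subst τ := by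
  induction e using Expr.rec_mem with
  | hvar x => simp [Expr.subst]
  | happ t es ih =>
    simp only [Expr.subst_app, List.map_map, Expr.app.injEq, true_and]
    exact List.map_congr_left ih

theorem SortE.subst_congr {σ τ : A.Var → Expr A} (U : SortE A)
    (h : ∀ v, SOccurs v U → σ v = τ v) : U.subst σ = U.subst τ := by
  simp only [SortE.subst, SortE.mk.injEq, true_and]
  exact List.map_congr_left fun e he => e.subst_congr fun v hv => h v ⟨e, he, hv⟩

theorem SortE.subst_subst (σ τ : A.Var → Expr A) (U : SortE A) :
    (U.subst σ).subst τ = U.subst fun v => (σ v).subst τ := by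
  simp [SortE.subst, Expr.subst_subst]

theorem lookupV_zip_map_subst (τ : A.Var → Expr A) {xs : List A.Var} {f : List (Expr A)}
    (hlen : f.length = xs.length) {v : A.Var} (hv : v ∈ xs) :
    (lookupV (xs.zip f) v).subst τ = lookupV (xs.zip (f.map (Expr.subst τ))) v := by
  induction xs generalizing f with
  | nil => simp at hv
  | cons x xs ih =>
    cases f with
    | nil => simp at hlen
    | cons e f =>
      simp only [List.zip_cons_cons, List.map_cons, lookupV]
      split_ifs with h
      · rfl
      · exact ih (by simpa using hlen) ((List.mem_cons.1 hv).resolve_left (Ne.symm h))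

theorem lookupV_zip_take {xs : List A.Var} {f : List (Expr A)} (hlen : f.length = xs.length)
    {i : ℕ} {v : A.Var} (hv : v ∈ xs.take i) :
    lookupV ((xs.take i).zip (f.take i)) v = lookupV (xs.zip f) v := by
  induction xs generalizing f i with
  | nil => simp at hv
  | cons x xs ih =>
    cases f with
    | nil => simp at hlen
    | cons e f =>
      cases i with
      | zero => simp at hv
      | succ i =>
        simp only [List.take_succ_cons, List.zip_cons_cons, lookupV]
        split_ifs with h
        · rfl
        · exact ih (by simpa using hlen) ((List.mem_cons.1 hv).resolve_left (Ne.symm h))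

theorem lookupV_zip_getElem {xs : List A.Var} (hxs : xs.Nodup) {f : List (Expr A)} {i : ℕ}
    (hi : i < xs.length) (hif : i < f.length) : lookupV (xs.zip f) xs[i] = f[i] := by
  induction xs generalizing f i with
  | nil => simp at hi
  | cons x xs ih =>
    cases f with
    | nil => simp at hif
    | cons e f =>
      obtain ⟨hx, hxs⟩ := List.nodup_cons.1 hxs
      cases i with
      | zero => simp [lookupV]
      | succ i =>
        have hi' : i < xs.length := by simpa using hi
        have hne : x ≠ xs[i] := fun h => hx (h ▸ List.getElem_mem hi')
        simpa [lookupV, hne] using ih hxs hi' (by simpa using hif)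

/-- A precontext with pairwise distinct variables. -/
def WellScoped (X : PreCtx A) : Prop := IsPreCtx X ∧ (X.map Prod.fst).Nodup

/-- All variables of the term are declared by the precontext. -/
def ExprIn (X : PreCtx A) (e : Expr A) : Prop := ∀ v, Occurs v e → v ∈ X.map Prod.fst

/-- All variables of the sort are declared by the precontext. -/
def SortIn (X : PreCtx A) (U : SortE A) : Prop := ∀ v, SOccurs v U → v ∈ X.map Prod.fst

theorem exprIn_app {X : PreCtx A} {t : A.TermSym} {es : List (Expr A)} :
    ExprIn X (.app t es) ↔ ∀ e ∈ es, ExprIn X e := by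
  refine ⟨fun h e he v hv => h v (.app he hv), fun h v hv => ?_⟩
  cases hv with
  | app he hv => exact h _ he v hv

theorem sortIn_iff {X : PreCtx A} {U : SortE A} :
    SortIn X U ↔ ∀ e ∈ U.args, ExprIn X e :=
  ⟨fun h e he v hv => h v ⟨e, he, hv⟩, fun h v ⟨e, he, hv⟩ => h e he v hv⟩

theorem exprIn_var {X : PreCtx A} {x : A.Var} (hx : x ∈ X.map Prod.fst) :
    ExprIn X (.var x) := by
  intro v hv
  cases hv
  exact hx

theorem exprIn_of_mem_ctxVars {X : PreCtx A} {e : Expr A} (he : e ∈ ctxVars X) :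
    ExprIn X e := by
  obtain ⟨p, hp, rfl⟩ := List.mem_map.1 he
  exact exprIn_var (List.mem_map_of_mem hp)

theorem Expr.substL_substL {X : PreCtx A} {e : Expr A} (he : ExprIn X e)
    {f : List (Expr A)} (hlen : f.length = X.length) (ps : List (A.Var × Expr A)) :
    (e.substL (mkSub X f)).substL ps = e.substL (mkSub X (f.map fun a => a.substL ps)) := by
  simp only [Expr.substL, Expr.subst_subst]
  exact e.subst_congr fun v hv => lookupV_zip_map_subst _ (by simpa using hlen) (he v hv)

theorem SortE.substL_substL {X : PreCtx A} {U : SortE A} (hU : SortIn X U)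
    {f : List (Expr A)} (hlen : f.length = X.length) (ps : List (A.Var × Expr A)) :
    (U.substL (mkSub X f)).substL ps = U.substL (mkSub X (f.map fun a => a.substL ps)) := by
  simp only [SortE.substL, SortE.subst_subst]
  exact U.subst_congr fun v hv => lookupV_zip_map_subst _ (by simpa using hlen) (hU v hv)

theorem IsPreCtx.sortIn_take {X : PreCtx A} (hX : IsPreCtx X) {i : ℕ} (hi : i < X.length) :
    SortIn (X.take i) (X[i]'hi).2 :=
  hX i hi

theorem subPre_eq {X : PreCtx A} (hX : IsPreCtx X) {f : List (Expr A)}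
    (hlen : f.length = X.length) {i : ℕ} (hi : i < X.length) :
    subPre X f i hi = (X[i]'hi).2.substL (mkSub X f) := by
  refine SortE.subst_congr _ fun v hv => ?_
  have hv' := hX i hi v hv
  rw [List.map_take] at hv'
  simpa only [mkSub, List.map_take] using lookupV_zip_take (by simpa using hlen) hv'

theorem subPre_substL {X : PreCtx A} (hX : IsPreCtx X) {f : List (Expr A)}
    (hlen : f.length = X.length) {i : ℕ} (hi : i < X.length) (ps : List (A.Var × Expr A)) :
    (subPre X f i hi).substL ps = subPre X (f.map fun a => a.substL ps) i hi := by
  rw [subPre, SortE.substL_substL (hX.sortIn_take hi) (by simp [hlen]), List.map_take]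
  rfl

theorem substL_getElem {X : PreCtx A} (hX : WellScoped X) {f : List (Expr A)} {i : ℕ}
    (hi : i < X.length) (hif : i < f.length) :
    (Expr.var (X[i]'hi).1).substL (mkSub X f) = f[i] := by
  have := lookupV_zip_getElem hX.2 (f := f) (i := i) (by simpa using hi) hif
  simpa [Expr.substL, Expr.subst, mkSub] using this

theorem ctxVars_map_substL {X : PreCtx A} (hX : WellScoped X) {f : List (Expr A)}
    (hlen : f.length = X.length) :
    (ctxVars X).map (fun e => e.substL (mkSub X f)) = f := by
  refine List.ext_getElem (by simp [ctxVars, hlen]) fun i hi hif => ?_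
  simpa [ctxVars] using substL_getElem hX (hlen ▸ hif) hif

theorem SortE.substL_mk (S : A.SortSym) (es : List (Expr A)) (ps : List (A.Var × Expr A)) :
    (⟨S, es⟩ : SortE A).substL ps = ⟨S, es.map fun e => e.substL ps⟩ :=
  rfl

theorem Expr.substL_app (t : A.TermSym) (es : List (Expr A)) (ps : List (A.Var × Expr A)) :
    (Expr.app t es).substL ps = .app t (es.map fun e => e.substL ps) :=
  Expr.subst_app _ t es

section Derivability

variable {Ax : Set (Judg A)}

theorem Step.mono {D D' : Judg A → Prop} (h : ∀ J, D J → D' J) {J : Judg A}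
    (hJ : Step Ax D J) : Step Ax D' J := by
  induction hJ with
  | ctx_nil => exact .ctx_nil
  | ctx_cons hs hfresh hpre => exact .ctx_cons (h _ hs) hfresh hpre
  | s1 h1 => exact .s1 (h _ h1)
  | s2 h1 => exact .s2 (h _ h1)
  | s3 h1 h2 => exact .s3 (h _ h1) (h _ h2)
  | t1 h1 => exact .t1 (h _ h1)
  | t2 h1 => exact .t2 (h _ h1)
  | t3 h1 h2 => exact .t3 (h _ h1) (h _ h2)
  | seqt h1 h2 => exact .seqt (h _ h1) (h _ h2)
  | seqteq h1 h2 h3 h4 => exact .seqteq (h _ h1) (h _ h2) (h _ h3) (h _ h4)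
  | var hi h1 => exact .var hi (h _ h1)
  | sA hax h1 hv => exact .sA hax (h _ h1) fun i hi => h _ (hv i hi)
  | tA hax h1 hv => exact .tA hax (h _ h1) fun i hi => h _ (hv i hi)
  | seqA hax h1 h2 => exact .seqA hax (h _ h1) (h _ h2)
  | teqA hax h1 h2 => exact .teqA hax (h _ h1) (h _ h2)
  | sSub hax hY hlen hJ hYc hargs =>
    exact .sSub hax hY hlen (h _ hJ) (h _ hYc) fun i hi hif => h _ (hargs i hi hif)
  | tSub hax hY hlen hJ hU hargs =>
    exact .tSub hax hY hlen (h _ hJ) (h _ hU) fun i hi hif => h _ (hargs i hi hif)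
  | seqSub1 hax hY hlen hJ h1 h2 hargs =>
    exact .seqSub1 hax hY hlen (h _ hJ) (h _ h1) (h _ h2)
      fun i hi hif => h _ (hargs i hi hif)
  | seqSub2 hax hY hlf hlg hJ h1 h2 hargs =>
    exact .seqSub2 hax hY hlf hlg (h _ hJ) (h _ h1) (h _ h2)
      fun i hi hif hig => h _ (hargs i hi hif hig)
  | teqSub1 hax hY hlen hJ h1 h2 hargs =>
    exact .teqSub1 hax hY hlen (h _ hJ) (h _ h1) (h _ h2)
      fun i hi hif => h _ (hargs i hi hif)
  | teqSub2 hax hY hlf hlg hJ h1 h2 hargs =>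
    exact .teqSub2 hax hY hlf hlg (h _ hJ) (h _ h1) (h _ h2)
      fun i hi hif hig => h _ (hargs i hi hif hig)

theorem DerAt.mono {m n : ℕ} (hmn : m ≤ n) {J : Judg A} (h : DerAt Ax m J) :
    DerAt Ax n J := by
  induction hmn with
  | refl => exact h
  | step _ ih => exact Or.inl ih

theorem Derivable.eventually {J : Judg A} (h : Derivable Ax J) :
    ∀ᶠ n in Filter.atTop, DerAt Ax n J := by
  obtain ⟨m, hm⟩ := h
  filter_upwards [Filter.eventually_ge_atTop m] with n hn
  exact hm.mono hn

theorem eventually_forall_lt {k : ℕ} {p : ∀ i, i < k → ℕ → Prop}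
    (h : ∀ i hi, ∀ᶠ n in Filter.atTop, p i hi n) :
    ∀ᶠ n in Filter.atTop, ∀ i hi, p i hi n :=
  (Filter.eventually_all.2 fun i : Fin k => h i i.2).mono fun _ hn i hi => hn ⟨i, hi⟩

theorem Derivable.eventually_args {X Y : PreCtx A} {f : List (Expr A)}
    (h : ∀ i (hi : i < X.length) (hif : i < f.length),
      Derivable Ax (.term Y (f[i]'hif) (subPre X f i hi))) :
    ∀ᶠ n in Filter.atTop, ∀ i (hi : i < X.length) (hif : i < f.length),
      DerAt Ax n (.term Y (f[i]'hif) (subPre X f i hi)) :=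
  eventually_forall_lt fun i hi => Filter.eventually_all.2 fun hif => (h i hi hif).eventually

theorem Derivable.eventually_eqArgs {X Y : PreCtx A} {f g : List (Expr A)}
    (h : ∀ i (hi : i < X.length) (hif : i < f.length) (hig : i < g.length),
      Derivable Ax (.termEq Y (f[i]'hif) (g[i]'hig) (subPre X f i hi))) :
    ∀ᶠ n in Filter.atTop, ∀ i (hi : i < X.length) (hif : i < f.length) (hig : i < g.length),
      DerAt Ax n (.termEq Y (f[i]'hif) (g[i]'hig) (subPre X f i hi)) :=
  eventually_forall_lt fun i hi => Filter.eventually_all.2 fun hif =>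
    Filter.eventually_all.2 fun hig => (h i hi hif hig).eventually

theorem Step.eventually {J : Judg A} (hJ : Step Ax (Derivable Ax) J) :
    ∀ᶠ n in Filter.atTop, Step Ax (DerAt Ax n) J := by
  induction hJ with
  | ctx_nil => exact .of_forall fun _ => .ctx_nil
  | ctx_cons hs hfresh hpre =>
    filter_upwards [hs.eventually] with n h1 using .ctx_cons h1 hfresh hpre
  | s1 h1 => filter_upwards [h1.eventually] with n h1 using .s1 h1
  | s2 h1 => filter_upwards [h1.eventually] with n h1 using .s2 h1
  | s3 h1 h2 => filter_upwards [h1.eventually, h2.eventually] with n h1 h2 using .s3 h1 h2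
  | t1 h1 => filter_upwards [h1.eventually] with n h1 using .t1 h1
  | t2 h1 => filter_upwards [h1.eventually] with n h1 using .t2 h1
  | t3 h1 h2 => filter_upwards [h1.eventually, h2.eventually] with n h1 h2 using .t3 h1 h2
  | seqt h1 h2 =>
    filter_upwards [h1.eventually, h2.eventually] with n h1 h2 using .seqt h1 h2
  | seqteq h1 h2 h3 h4 =>
    filter_upwards [h1.eventually, h2.eventually, h3.eventually, h4.eventually]
      with n h1 h2 h3 h4 using .seqteq h1 h2 h3 h4
  | var hi h1 => filter_upwards [h1.eventually] with n h1 using .var hi h1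
  | sA hax h1 hv =>
    filter_upwards [h1.eventually, eventually_forall_lt fun i hi => (hv i hi).eventually]
      with n h1 hv using .sA hax h1 hv
  | tA hax h1 hv =>
    filter_upwards [h1.eventually, eventually_forall_lt fun i hi => (hv i hi).eventually]
      with n h1 hv using .tA hax h1 hv
  | seqA hax h1 h2 =>
    filter_upwards [h1.eventually, h2.eventually] with n h1 h2 using .seqA hax h1 h2
  | teqA hax h1 h2 =>
    filter_upwards [h1.eventually, h2.eventually] with n h1 h2 using .teqA hax h1 h2
  | sSub hax hY hlen hJ hYc hargs =>
    filter_upwards [hJ.eventually, hYc.eventually, Derivable.eventually_args hargs]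
      with n hJ hYc hargs using .sSub hax hY hlen hJ hYc hargs
  | tSub hax hY hlen hJ hU hargs =>
    filter_upwards [hJ.eventually, hU.eventually, Derivable.eventually_args hargs]
      with n hJ hU hargs using .tSub hax hY hlen hJ hU hargs
  | seqSub1 hax hY hlen hJ h1 h2 hargs =>
    filter_upwards [hJ.eventually, h1.eventually, h2.eventually,
      Derivable.eventually_args hargs] with n hJ h1 h2 hargs
      using .seqSub1 hax hY hlen hJ h1 h2 hargs
  | seqSub2 hax hY hlf hlg hJ h1 h2 hargs =>
    filter_upwards [hJ.eventually, h1.eventually, h2.eventually,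
      Derivable.eventually_eqArgs hargs] with n hJ h1 h2 hargs
      using .seqSub2 hax hY hlf hlg hJ h1 h2 hargs
  | teqSub1 hax hY hlen hJ h1 h2 hargs =>
    filter_upwards [hJ.eventually, h1.eventually, h2.eventually,
      Derivable.eventually_args hargs] with n hJ h1 h2 hargs
      using .teqSub1 hax hY hlen hJ h1 h2 hargs
  | teqSub2 hax hY hlf hlg hJ h1 h2 hargs =>
    filter_upwards [hJ.eventually, h1.eventually, h2.eventually,
      Derivable.eventually_eqArgs hargs] with n hJ h1 h2 hargs
      using .teqSub2 hax hY hlf hlg hJ h1 h2 hargs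

/-- The derivable judgments are closed under the inference rules. -/
theorem Step.derivable {J : Judg A} (hJ : Step Ax (Derivable Ax) J) : Derivable Ax J := by
  obtain ⟨n, hn⟩ := hJ.eventually.exists
  exact ⟨n + 1, Or.inr hn⟩

/-- Induction on derivations. -/
theorem Derivable.induction {P : Judg A → Prop}
    (hstep : ∀ J, Step Ax (fun J => Derivable Ax J ∧ P J) J → P J) {J : Judg A}
    (hJ : Derivable Ax J) : P J := by
  obtain ⟨n, hn⟩ := hJ
  induction n generalizing J with
  | zero => exact hn.elim
  | succ n ih =>
    rcases hn with hn | hn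
    · exact ih hn
    · exact hstep J (hn.mono fun K hK => ⟨⟨n, hK⟩, ih hK⟩)

/-- The context of the judgment has distinct, properly scoped variables, and the judgment
only mentions variables of its context. -/
def Judg.Scoped : Judg A → Prop
  | .ctx X => WellScoped X
  | .sort X U => WellScoped X ∧ SortIn X U
  | .term X u U => WellScoped X ∧ ExprIn X u ∧ SortIn X U
  | .sortEq X U V => WellScoped X ∧ SortIn X U ∧ SortIn X V
  | .termEq X u v U => WellScoped X ∧ ExprIn X u ∧ ExprIn X v ∧ SortIn X U

theorem Derivable.scoped (hAx : IsPretheory Ax) {J : Judg A} (hJ : Derivable Ax J) :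
    J.Scoped := by
  refine Derivable.induction (fun J hJ => ?_) hJ
  cases hJ with
  | ctx_nil => exact ⟨fun i hi => absurd hi (by simp), by simp⟩
  | ctx_cons hs hfresh hpre =>
    refine ⟨hpre, ?_⟩
    rw [List.map_append, List.nodup_append]
    refine ⟨hs.2.1.2, by simp, fun a ha b hb => ?_⟩
    obtain ⟨p, hp, rfl⟩ := List.mem_map.1 ha
    obtain rfl : b = _ := by simpa using hb
    exact hfresh p hp
  | s1 h => exact ⟨h.2.1, h.2.2, h.2.2⟩
  | s2 h => exact ⟨h.2.1, h.2.2.2, h.2.2.1⟩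
  | s3 h1 h2 => exact ⟨h1.2.1, h1.2.2.1, h2.2.2.2⟩
  | t1 h => exact ⟨h.2.1, h.2.2.1, h.2.2.1, h.2.2.2⟩
  | t2 h => exact ⟨h.2.1, h.2.2.2.1, h.2.2.1, h.2.2.2.2⟩
  | t3 h1 h2 => exact ⟨h1.2.1, h1.2.2.1, h2.2.2.2.1, h1.2.2.2.2⟩
  | seqt h1 h2 => exact ⟨h1.2.1, h2.2.2.1, h1.2.2.2⟩
  | seqteq h1 h2 h3 h4 => exact ⟨h1.2.1, h3.2.2.1, h4.2.2.1, h1.2.2.2⟩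
  | var hi h =>
    exact ⟨h.2.1, exprIn_var (List.mem_map_of_mem (List.getElem_mem hi)), h.2.2⟩
  | sA hax h hv =>
    refine ⟨h.2, sortIn_iff.2 fun e he => exprIn_of_mem_ctxVars ?_⟩
    rwa [hAx.sort_shape _ _ hax] at he
  | tA hax h hv =>
    obtain ⟨t, rfl⟩ := hAx.term_shape _ _ _ hax
    exact ⟨h.2.1, exprIn_app.2 fun e he => exprIn_of_mem_ctxVars he, h.2.2⟩
  | seqA hax h1 h2 => exact ⟨h1.2.1, h1.2.2, h2.2.2⟩
  | teqA hax h1 h2 => exact ⟨h1.2.1, h1.2.2.1, h2.2.2.1, h1.2.2.2⟩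
  | sSub hax hY hlen hJ hYc hargs =>
    refine ⟨hYc.2, sortIn_iff.2 fun e he => ?_⟩
    obtain ⟨i, hi, rfl⟩ := List.getElem_of_mem he
    exact (hargs i (hlen ▸ hi) hi).2.2.1
  | tSub hax hY hlen hJ hU hargs =>
    refine ⟨hU.2.1, exprIn_app.2 fun e he => ?_, hU.2.2⟩
    obtain ⟨i, hi, rfl⟩ := List.getElem_of_mem he
    exact (hargs i (hlen ▸ hi) hi).2.2.1
  | seqSub1 hax hY hlen hJ h1 h2 hargs => exact ⟨h1.2.1, h1.2.2, h2.2.2⟩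
  | seqSub2 hax hY hlf hlg hJ h1 h2 hargs => exact ⟨h1.2.1, h1.2.2, h2.2.2⟩
  | teqSub1 hax hY hlen hJ h1 h2 hargs => exact ⟨h1.2.1, h1.2.2.1, h2.2.2.1, h1.2.2.2⟩
  | teqSub2 hax hY hlf hlg hJ h1 h2 hargs => exact ⟨h1.2.1, h1.2.2.1, h2.2.2.1, h1.2.2.2⟩

/-- Substitution of a judgment along `f`, as a judgment over `Y`. -/
noncomputable def Judg.substAlong (Y : PreCtx A) (f : List (Expr A)) : Judg A → Judg A
  | .ctx _ => .ctx Y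
  | .sort X U => .sort Y (U.substL (mkSub X f))
  | .term X u U => .term Y (u.substL (mkSub X f)) (U.substL (mkSub X f))
  | .sortEq X U V => .sortEq Y (U.substL (mkSub X f)) (V.substL (mkSub X f))
  | .termEq X u v U =>
    .termEq Y (u.substL (mkSub X f)) (v.substL (mkSub X f)) (U.substL (mkSub X f))

theorem Derivable.substAlong (hAx : IsPretheory Ax) {J : Judg A} (hJ : Derivable Ax J) :
    ∀ (Z : PreCtx A) (g : List (Expr A)), IsMor Ax Z J.ctxOf g →
      Derivable Ax (J.substAlong Z g) := by
  refine Derivable.induction (P := fun J => ∀ (Z : PreCtx A) (g : List (Expr A)),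
    IsMor Ax Z J.ctxOf g → Derivable Ax (J.substAlong Z g)) (fun J hJ Z g hg => ?_) hJ
  obtain ⟨hZ, hX, hlg, hargs_g⟩ := id hg
  have hZs : IsPreCtx Z := (hZ.scoped hAx).1
  have hXs : WellScoped J.ctxOf := hX.scoped hAx
  have hself : Derivable Ax J := (hJ.mono fun _ h => h.1).derivable
  cases hJ with
  | ctx_nil => exact hZ
  | ctx_cons hs hfresh hpre => exact hZ
  | s1 h => exact (Step.s1 (h.2 Z g hg)).derivable
  | s2 h => exact (Step.s2 (h.2 Z g hg)).derivable
  | s3 h1 h2 => exact (Step.s3 (h1.2 Z g hg) (h2.2 Z g hg)).derivable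
  | t1 h => exact (Step.t1 (h.2 Z g hg)).derivable
  | t2 h => exact (Step.t2 (h.2 Z g hg)).derivable
  | t3 h1 h2 => exact (Step.t3 (h1.2 Z g hg) (h2.2 Z g hg)).derivable
  | seqt h1 h2 => exact (Step.seqt (h1.2 Z g hg) (h2.2 Z g hg)).derivable
  | seqteq h1 h2 h3 h4 =>
    exact (Step.seqteq (h1.2 Z g hg) (h2.2 Z g hg) (h3.2 Z g hg) (h4.2 Z g hg)).derivable
  | @var X i hi h =>
    have hif : i < g.length := hlg.symm ▸ hi
    have := hargs_g i hi hif
    rw [subPre_eq hXs.1 hlg hi] at this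
    simp only [Judg.substAlong]
    rwa [substL_getElem (X := X) hXs hi hif]
  | @sA X U hax h hv =>
    obtain ⟨S, es⟩ := U
    obtain rfl : es = ctxVars X := hAx.sort_shape _ _ hax
    simp only [Judg.substAlong, SortE.substL_mk]
    rw [ctxVars_map_substL (X := X) hXs hlg]
    exact (Step.sSub hax hZs hlg hself hZ hargs_g).derivable
  | @tA X u U hax h hv =>
    obtain ⟨t, rfl⟩ := hAx.term_shape _ _ _ hax
    simp only [Judg.substAlong, Expr.substL_app]
    rw [ctxVars_map_substL (X := X) hXs hlg]
    exact (Step.tSub hax hZs hlg hself (h.2 Z g hg) hargs_g).derivable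
  | seqA hax h1 h2 =>
    exact (Step.seqSub1 hax hZs hlg hself (h1.2 Z g hg) (h2.2 Z g hg) hargs_g).derivable
  | teqA hax h1 h2 =>
    exact (Step.teqSub1 hax hZs hlg hself (h1.2 Z g hg) (h2.2 Z g hg) hargs_g).derivable
  | sSub hax hY hlen hJ hYc hargs =>
    refine (Step.sSub hax hZs (by simpa using hlen) hJ.1 hZ fun i hi hif => ?_).derivable
    have := (hargs i hi (hlen.symm ▸ hi)).2 Z g hg
    simp only [Judg.substAlong, subPre_substL (hJ.1.scoped hAx).1.1 hlen] at this
    rw [List.getElem_map]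
    exact this
  | @tSub W t U hax Y hY f hlen hJ hU hargs =>
    have hWs := hJ.1.scoped hAx
    have hU' := hU.2 Z g hg
    simp only [Judg.substAlong, Expr.substL_app, SortE.substL_substL hWs.2.2 hlen] at hU' ⊢
    refine (Step.tSub hax hZs (by simpa using hlen) hJ.1 hU' fun i hi hif => ?_).derivable
    have := (hargs i hi (hlen.symm ▸ hi)).2 Z g hg
    simp only [Judg.substAlong, subPre_substL hWs.1.1 hlen] at this
    rw [List.getElem_map]
    exact this
  | seqSub1 hax hY hlen hJ h1 h2 hargs =>
    have hWs := hJ.1.scoped hAx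
    have h1' := h1.2 Z g hg
    have h2' := h2.2 Z g hg
    simp only [Judg.substAlong, SortE.substL_substL hWs.2.1 hlen,
      SortE.substL_substL hWs.2.2 hlen] at h1' h2' ⊢
    refine (Step.seqSub1 hax hZs (by simpa using hlen) hJ.1 h1' h2'
      fun i hi hif => ?_).derivable
    have := (hargs i hi (hlen.symm ▸ hi)).2 Z g hg
    simp only [Judg.substAlong, subPre_substL hWs.1.1 hlen] at this
    rw [List.getElem_map]
    exact this
  | seqSub2 hax hY hlf hlg' hJ h1 h2 hargs =>
    have hWs := hJ.1.scoped hAx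
    refine (Step.seqSub2 hax hZs (by simpa using hlf) (by simpa using hlg') hJ.1
      (h1.2 Z g hg) (h2.2 Z g hg) fun i hi hif hig => ?_).derivable
    have := (hargs i hi (hlf.symm ▸ hi) (hlg'.symm ▸ hi)).2 Z g hg
    simp only [Judg.substAlong, subPre_substL hWs.1.1 hlf] at this
    rw [List.getElem_map, List.getElem_map]
    exact this
  | teqSub1 hax hY hlen hJ h1 h2 hargs =>
    have hWs := hJ.1.scoped hAx
    have h1' := h1.2 Z g hg
    have h2' := h2.2 Z g hg
    simp only [Judg.substAlong, Expr.substL_substL hWs.2.1 hlen,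
      Expr.substL_substL hWs.2.2.1 hlen, SortE.substL_substL hWs.2.2.2 hlen] at h1' h2' ⊢
    refine (Step.teqSub1 hax hZs (by simpa using hlen) hJ.1 h1' h2'
      fun i hi hif => ?_).derivable
    have := (hargs i hi (hlen.symm ▸ hi)).2 Z g hg
    simp only [Judg.substAlong, subPre_substL hWs.1.1 hlen] at this
    rw [List.getElem_map]
    exact this
  | teqSub2 hax hY hlf hlg' hJ h1 h2 hargs =>
    have hWs := hJ.1.scoped hAx
    have h1' := h1.2 Z g hg
    have h2' := h2.2 Z g hg
    simp only [Judg.substAlong, Expr.substL_app,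
      SortE.substL_substL hWs.2.2 hlf] at h1' h2' ⊢
    refine (Step.teqSub2 hax hZs (by simpa using hlf) (by simpa using hlg') hJ.1
      h1' h2' fun i hi hif hig => ?_).derivable
    have := (hargs i hi (hlf.symm ▸ hi) (hlg'.symm ▸ hi)).2 Z g hg
    simp only [Judg.substAlong, subPre_substL hWs.1.1 hlf] at this
    rw [List.getElem_map, List.getElem_map]
    exact this

end Derivability

/-- **substitution property.** In a pretheory, every derivable
standard judgment has the substitution property: substituting along any context
morphism `f : Y → X` yields a derivable judgment over `Y`. -/
theorem substitution_property (A : Alphabet) (Ax : Set (Judg A)) (hAx : IsPretheory Ax) :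
    (∀ (X : PreCtx A) (U : SortE A) (Y : PreCtx A) (f : List (Expr A)),
        Derivable Ax (.sort X U) → IsMor Ax Y X f →
        Derivable Ax (.sort Y (U.substL (mkSub X f)))) ∧
    (∀ (X : PreCtx A) (u : Expr A) (U : SortE A) (Y : PreCtx A) (f : List (Expr A)),
        Derivable Ax (.term X u U) → IsMor Ax Y X f →
        Derivable Ax (.term Y (u.substL (mkSub X f)) (U.substL (mkSub X f)))) ∧
    (∀ (X : PreCtx A) (U U' : SortE A) (Y : PreCtx A) (f : List (Expr A)),
        Derivable Ax (.sortEq X U U') → IsMor Ax Y X f →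
        Derivable Ax (.sortEq Y (U.substL (mkSub X f)) (U'.substL (mkSub X f)))) ∧
    (∀ (X : PreCtx A) (u u' : Expr A) (U : SortE A) (Y : PreCtx A) (f : List (Expr A)),
        Derivable Ax (.termEq X u u' U) → IsMor Ax Y X f →
        Derivable Ax (.termEq Y (u.substL (mkSub X f)) (u'.substL (mkSub X f))
          (U.substL (mkSub X f)))) :=
  ⟨fun _ _ Y f h hf => h.substAlong hAx Y f hf, fun _ _ _ Y f h hf => h.substAlong hAx Y f hf,
    fun _ _ _ Y f h hf => h.substAlong hAx Y f hf,
    fun _ _ _ _ Y f h hf => h.substAlong hAx Y f hf⟩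

end GATPaper
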